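/- Einstein gyrations satisfy the left loop property: for all u, v, w in the c-ball V_c, gyr[u ⊕ v, v]w = gyr[u,v]w. -/

import Mathlib

open scoped RealInnerProductSpace

noncomputable def gamma {V : Type*} [NormedAddCommGroup V] [InnerProductSpace ℝ V]
    (c : ℝ) (u : V) : ℝ :=
  1 / Real.sqrt (1 - ‖u‖ ^ 2 / c ^ 2)

noncomputable def eAdd {V : Type*} [NormedAddCommGroup V] [InnerProductSpace ℝ V]
    (c : ℝ) (u v : V) : V :=
  (1 / (1 + ⟪u, v⟫ / c ^ 2)) •
    (u + (1 / gamma c u) • v +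
      ((1 / c ^ 2) * (gamma c u / (1 + gamma c u)) * ⟪u, v⟫) • u)

noncomputable def eGyr {V : Type*} [NormedAddCommGroup V] [InnerProductSpace ℝ V]
    (c : ℝ) (u v w : V) : V :=
  eAdd c (-(eAdd c u v)) (eAdd c u (eAdd c v w))

noncomputable def eCoadd {V : Type*} [NormedAddCommGroup V] [InnerProductSpace ℝ V]
    (c : ℝ) (u v : V) : V :=
  eAdd c u (eGyr c u (-v) v)

noncomputable def mAdd {V : Type*} [NormedAddCommGroup V] [InnerProductSpace ℝ V]
    (s : ℝ) (u v : V) : V :=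
  (1 / (1 + (2 / s ^ 2) * ⟪u, v⟫ + (1 / s ^ 4) * ‖u‖ ^ 2 * ‖v‖ ^ 2)) •
    ((1 + (2 / s ^ 2) * ⟪u, v⟫ + (1 / s ^ 2) * ‖v‖ ^ 2) • u +
      (1 - (1 / s ^ 2) * ‖u‖ ^ 2) • v)

noncomputable def mGyr {V : Type*} [NormedAddCommGroup V] [InnerProductSpace ℝ V]
    (s : ℝ) (u v w : V) : V :=
  mAdd s (-(mAdd s u v)) (mAdd s u (mAdd s v w))

noncomputable def mCoadd {V : Type*} [NormedAddCommGroup V] [InnerProductSpace ℝ V]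
    (s : ℝ) (u v : V) : V :=
  mAdd s u (mGyr s u (-v) v)

noncomputable def artanh (x : ℝ) : ℝ :=
  (1 / 2) * Real.log ((1 + x) / (1 - x))

open Classical in
noncomputable def sMul {V : Type*} [NormedAddCommGroup V] [InnerProductSpace ℝ V]
    (c : ℝ) (r : ℝ) (v : V) : V :=
  if v = 0 then 0 else (c * Real.tanh (r * artanh (‖v‖ / c)) / ‖v‖) • v

section PointReflection

variable {W : Type*} [AddCommGroup W] [Module ℝ W]

/-- The reflection through the line spanned by `m`, with respect to the bilinear form `L`. -/
noncomputable def pointRefl (L : LinearMap.BilinForm ℝ W) (m y : W) : W :=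
  (2 * L m y / L m m) • m - y

variable {L : LinearMap.BilinForm ℝ W} {m k x y : W}

theorem pointRefl_add (m x y : W) :
    pointRefl L m (x + y) = pointRefl L m x + pointRefl L m y := by
  simp only [pointRefl, map_add]
  module

theorem pointRefl_smul_left {a : ℝ} (ha : a ≠ 0) (m y : W) :
    pointRefl L (a • m) y = pointRefl L m y := by
  simp only [pointRefl, map_smul, LinearMap.smul_apply, smul_eq_mul, smul_smul]
  congr 2
  field_simp

theorem pointRefl_pointRefl (hm : L m m ≠ 0) (y : W) :
    pointRefl L m (pointRefl L m y) = y := by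
  simp only [pointRefl, map_sub, map_smul, smul_eq_mul]
  match_scalars <;> field_simp
  ring

theorem apply_pointRefl (hL : ∀ x y, L x y = L y x) (hm : L m m ≠ 0) (x y : W) :
    L (pointRefl L m x) (pointRefl L m y) = L x y := by
  simp only [pointRefl, map_sub, map_smul, smul_eq_mul, LinearMap.sub_apply,
    LinearMap.smul_apply, hL x m]
  field_simp
  ring

theorem pointRefl_conj (hL : ∀ x y, L x y = L y x) (hm : L m m ≠ 0) (k y : W) :
    pointRefl L (pointRefl L m k) y = pointRefl L m (pointRefl L k (pointRefl L m y)) := by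
  have h : L (pointRefl L m k) y = L k (pointRefl L m y) := by
    rw [← apply_pointRefl hL hm k, pointRefl_pointRefl hm]
  conv_lhs => rw [pointRefl, h, apply_pointRefl hL hm]
  conv_rhs => rw [pointRefl.eq_1 L k]
  generalize 2 * L k (pointRefl L m y) / L k k = r
  simp only [pointRefl, map_sub, map_smul, smul_eq_mul]
  match_scalars <;> field_simp
  ring

theorem pointRefl_pointRefl_add_self (hk : L k k ≠ 0) (hkx : L k x ≠ 0) (y : W) :
    pointRefl L (pointRefl L k x + x) y = pointRefl L k y := by
  rw [pointRefl.eq_1 L k x, sub_add_cancel, pointRefl_smul_left]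
  positivity

end PointReflection

section Minkowski

variable {V : Type*} [NormedAddCommGroup V] [InnerProductSpace ℝ V]

/-- The Minkowski form of signature `(+, -, …)` on `ℝ × V`. -/
noncomputable def minkowski : LinearMap.BilinForm ℝ (ℝ × V) :=
  LinearMap.mk₂ ℝ (fun p q => p.1 * q.1 - ⟪p.2, q.2⟫)
    (fun p q r => by simp only [Prod.fst_add, Prod.snd_add, inner_add_left]; ring)
    (fun a p q => by
      simp only [Prod.smul_fst, Prod.smul_snd, real_inner_smul_left, smul_eq_mul]; ring)
    (fun p q r => by simp only [Prod.fst_add, Prod.snd_add, inner_add_right]; ring)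
    (fun a p q => by
      simp only [Prod.smul_fst, Prod.smul_snd, real_inner_smul_right, smul_eq_mul]; ring)

theorem minkowski_apply (p q : ℝ × V) : minkowski p q = p.1 * q.1 - ⟪p.2, q.2⟫ := rfl

theorem minkowski_comm (p q : ℝ × V) : minkowski p q = minkowski q p := by
  rw [minkowski_apply, minkowski_apply, real_inner_comm, mul_comm]

theorem minkowski_self (p : ℝ × V) : minkowski p p = p.1 ^ 2 - ‖p.2‖ ^ 2 := by
  rw [minkowski_apply, real_inner_self_eq_norm_sq, sq p.1]

/-- The observer at rest. -/
def restVector : ℝ × V := (1, 0)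

theorem minkowski_restVector (p : ℝ × V) : minkowski p restVector = p.1 := by
  simp [minkowski_apply, restVector]

theorem minkowski_restVector_self_ne_zero :
    minkowski (restVector : ℝ × V) restVector ≠ 0 := by
  rw [minkowski_restVector]
  exact one_ne_zero

theorem pointRefl_restVector (p : ℝ × V) : pointRefl minkowski restVector p = (p.1, -p.2) := by
  rw [pointRefl, minkowski_comm restVector p, minkowski_restVector, minkowski_restVector]
  ext
  · simp [restVector]; ring
  · simp [restVector]

/-- The four-velocity of a particle with velocity `u`. -/
noncomputable def fourVelocity (c : ℝ) (u : V) : ℝ × V :=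
  (gamma c u, (gamma c u / c) • u)

/-- The velocity of a particle with four-momentum `p`. -/
noncomputable def velocity (c : ℝ) (p : ℝ × V) : V :=
  (c / p.1) • p.2

/-- The direction of the hyperbolic midpoint of the rest vector and the four-velocity of `u`. -/
noncomputable def midVector (c : ℝ) (u : V) : ℝ × V :=
  fourVelocity c u + restVector

/-- The Lorentz boost with velocity `u`. -/
noncomputable def boost (c : ℝ) (u : V) (p : ℝ × V) : ℝ × V :=
  pointRefl minkowski (midVector c u) (pointRefl minkowski restVector p)

variable {c : ℝ} {u v w : V}

theorem one_sub_sq_div_sq_pos {r : ℝ} (hr : 0 ≤ r) (h : r < c) : 0 < 1 - r ^ 2 / c ^ 2 := by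
  have hc := hr.trans_lt h
  rw [sub_pos, div_lt_one (by positivity)]
  gcongr

theorem gamma_pos (hu : ‖u‖ < c) : 0 < gamma c u :=
  one_div_pos.2 (Real.sqrt_pos.2 (one_sub_sq_div_sq_pos (norm_nonneg u) hu))

theorem gamma_sq_mul (hu : ‖u‖ < c) : gamma c u ^ 2 * (1 - ‖u‖ ^ 2 / c ^ 2) = 1 := by
  have h := one_sub_sq_div_sq_pos (norm_nonneg u) hu
  rw [gamma, div_pow, Real.sq_sqrt h.le]
  field_simp

theorem minkowski_fourVelocity_self (hu : ‖u‖ < c) :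
    minkowski (fourVelocity c u) (fourVelocity c u) = 1 := by
  rw [minkowski_self, ← gamma_sq_mul hu]
  simp only [fourVelocity, norm_smul, mul_pow, Real.norm_eq_abs, sq_abs]
  ring

theorem velocity_fourVelocity (hu : ‖u‖ < c) : velocity c (fourVelocity c u) = u := by
  have hc := (norm_nonneg u).trans_lt hu
  have hg := gamma_pos hu
  simp only [velocity, fourVelocity, smul_smul]
  match_scalars
  field_simp

theorem norm_velocity_lt {p : ℝ × V} (hc : 0 < c) (hp : minkowski p p = 1) (h0 : 0 < p.1) :
    ‖velocity c p‖ < c := by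
  rw [minkowski_self] at hp
  have h : ‖p.2‖ < p.1 := lt_of_pow_lt_pow_left₀ 2 h0.le (by linarith)
  rw [velocity, norm_smul, Real.norm_of_nonneg (by positivity), div_mul_eq_mul_div,
    div_lt_iff₀ h0]
  gcongr

theorem fourVelocity_velocity {p : ℝ × V} (hc : 0 < c) (hp : minkowski p p = 1)
    (h0 : 0 < p.1) : fourVelocity c (velocity c p) = p := by
  rw [minkowski_self] at hp
  have hg : gamma c (velocity c p) = p.1 := by
    have h : 1 - ‖velocity c p‖ ^ 2 / c ^ 2 = (1 / p.1) ^ 2 := by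
      rw [velocity, norm_smul, Real.norm_of_nonneg (by positivity)]
      field_simp
      linarith
    rw [gamma, h, Real.sqrt_sq (by positivity), one_div_one_div]
  apply Prod.ext
  · exact hg
  · rw [fourVelocity, hg]
    simp only [velocity, smul_smul]
    match_scalars
    field_simp

theorem minkowski_midVector_self (hu : ‖u‖ < c) :
    minkowski (midVector c u) (midVector c u) = 2 * (1 + gamma c u) := by
  simp only [midVector, map_add, LinearMap.add_apply, minkowski_restVector,
    minkowski_fourVelocity_self hu, minkowski_comm restVector (fourVelocity c u)]
  simp only [fourVelocity, restVector]
  ring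

theorem minkowski_midVector_self_ne_zero (hu : ‖u‖ < c) :
    minkowski (midVector c u) (midVector c u) ≠ 0 := by
  have := gamma_pos hu
  rw [minkowski_midVector_self hu]
  positivity

theorem minkowski_boost (hu : ‖u‖ < c) (p q : ℝ × V) :
    minkowski (boost c u p) (boost c u q) = minkowski p q := by
  rw [boost, boost, apply_pointRefl minkowski_comm (minkowski_midVector_self_ne_zero hu),
    apply_pointRefl minkowski_comm minkowski_restVector_self_ne_zero]

theorem one_add_inner_div_pos (hu : ‖u‖ < c) (hv : ‖v‖ < c) : 0 < 1 + ⟪u, v⟫ / c ^ 2 := by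
  have hc := (norm_nonneg u).trans_lt hu
  have h1 := neg_le_of_abs_le (abs_real_inner_le_norm u v)
  have h2 : ‖u‖ * ‖v‖ < c * c := mul_lt_mul'' hu hv (norm_nonneg u) (norm_nonneg v)
  have h3 : -1 < ⟪u, v⟫ / c ^ 2 := by
    rw [lt_div_iff₀ (by positivity)]
    nlinarith
  linarith

theorem boost_fourVelocity (hu : ‖u‖ < c) (v : V) :
    boost c u (fourVelocity c v) =
      (gamma c u * gamma c v * (1 + ⟪u, v⟫ / c ^ 2),
        (gamma c v / c) • (gamma c u • u + v +
          (gamma c u ^ 2 / (1 + gamma c u) * (⟪u, v⟫ / c ^ 2)) • u)) := by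
  have hc := (norm_nonneg u).trans_lt hu
  have hg := gamma_pos hu
  rw [boost, pointRefl_restVector, pointRefl, minkowski_midVector_self hu, minkowski_apply]
  simp only [midVector, fourVelocity, restVector, Prod.fst_add, Prod.snd_add, add_zero,
    inner_neg_right, real_inner_smul_left, real_inner_smul_right]
  ext
  · simp only [Prod.fst_sub, Prod.smul_fst, smul_eq_mul, Prod.fst_add]
    field_simp
    ring
  · simp only [Prod.snd_sub, Prod.smul_snd, Prod.snd_add]
    match_scalars <;> field_simp
    ring

theorem velocity_boost (hu : ‖u‖ < c) (hv : ‖v‖ < c) :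
    velocity c (boost c u (fourVelocity c v)) = eAdd c u v := by
  have hc := (norm_nonneg u).trans_lt hu
  have hg := gamma_pos hu
  have hg' := gamma_pos hv
  have h := one_add_inner_div_pos hu hv
  rw [boost_fourVelocity hu, velocity, eAdd]
  have h' : c ^ 2 + ⟪u, v⟫ ≠ 0 := by
    rw [one_add_div (by positivity)] at h
    exact (div_ne_zero_iff.1 h.ne').1
  match_scalars <;> field_simp

theorem boost_fourVelocity_fst_pos (hu : ‖u‖ < c) (hv : ‖v‖ < c) :
    0 < (boost c u (fourVelocity c v)).1 := by
  rw [boost_fourVelocity hu]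
  exact mul_pos (mul_pos (gamma_pos hu) (gamma_pos hv)) (one_add_inner_div_pos hu hv)

theorem minkowski_boost_fourVelocity_self (hu : ‖u‖ < c) (hv : ‖v‖ < c) :
    minkowski (boost c u (fourVelocity c v)) (boost c u (fourVelocity c v)) = 1 := by
  rw [minkowski_boost hu, minkowski_fourVelocity_self hv]

theorem norm_eAdd_lt (hu : ‖u‖ < c) (hv : ‖v‖ < c) : ‖eAdd c u v‖ < c := by
  rw [← velocity_boost hu hv]
  exact norm_velocity_lt ((norm_nonneg u).trans_lt hu)
    (minkowski_boost_fourVelocity_self hu hv) (boost_fourVelocity_fst_pos hu hv)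

theorem fourVelocity_eAdd (hu : ‖u‖ < c) (hv : ‖v‖ < c) :
    fourVelocity c (eAdd c u v) = boost c u (fourVelocity c v) := by
  rw [← velocity_boost hu hv]
  exact fourVelocity_velocity ((norm_nonneg u).trans_lt hu)
    (minkowski_boost_fourVelocity_self hu hv) (boost_fourVelocity_fst_pos hu hv)

theorem fourVelocity_injOn : Set.InjOn (fourVelocity c) {v : V | ‖v‖ < c} :=
  fun u hu v hv h => by rw [← velocity_fourVelocity hu, h, velocity_fourVelocity hv]

theorem midVector_neg (c : ℝ) (u : V) :
    midVector c (-u) = pointRefl minkowski restVector (midVector c u) := by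
  rw [pointRefl_restVector]
  simp [midVector, fourVelocity, restVector, gamma]

theorem boost_neg_boost (hu : ‖u‖ < c) (p : ℝ × V) : boost c (-u) (boost c u p) = p := by
  have h0 := minkowski_restVector_self_ne_zero (V := V)
  rw [boost, midVector_neg, pointRefl_conj minkowski_comm h0, pointRefl_pointRefl h0, boost,
    pointRefl_pointRefl (minkowski_midVector_self_ne_zero hu), pointRefl_pointRefl h0]

theorem neg_eAdd_cancel_left (hu : ‖u‖ < c) (hv : ‖v‖ < c) :
    eAdd c (-u) (eAdd c u v) = v := by
  have hu' : ‖-u‖ < c := by rwa [norm_neg]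
  have huv := norm_eAdd_lt hu hv
  apply fourVelocity_injOn (norm_eAdd_lt hu' huv) hv
  rw [fourVelocity_eAdd hu' huv, fourVelocity_eAdd hu hv, boost_neg_boost hu]

theorem eAdd_neg_cancel_left (hu : ‖u‖ < c) (hv : ‖v‖ < c) :
    eAdd c u (eAdd c (-u) v) = v := by
  simpa using neg_eAdd_cancel_left (u := -u) (by rwa [norm_neg]) hv

theorem pointRefl_midVector_restVector (hu : ‖u‖ < c) :
    pointRefl minkowski (midVector c u) restVector = fourVelocity c u := by
  have hg := gamma_pos hu
  have h : 2 * (1 + gamma c u) ≠ 0 := by positivity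
  have h1 : 2 * (midVector c u).1 = 2 * (1 + gamma c u) := by
    simp [midVector, fourVelocity, restVector, add_comm]
  rw [pointRefl, minkowski_midVector_self hu, minkowski_restVector, h1, div_self h, one_smul,
    midVector, add_sub_cancel_right]

theorem boost_eAdd_eAdd (hu : ‖u‖ < c) (hv : ‖v‖ < c) (p : ℝ × V) :
    boost c (eAdd c u (eAdd c v u)) p = boost c u (boost c v (boost c u p)) := by
  have h0 := minkowski_restVector_self_ne_zero (V := V)
  have hmu := minkowski_midVector_self_ne_zero hu
  set k := pointRefl minkowski (midVector c u)
    (pointRefl minkowski restVector (midVector c v)) with hk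
  have hconj (y : ℝ × V) : pointRefl minkowski k y =
      boost c u (boost c v (pointRefl minkowski (midVector c u) y)) := by
    rw [hk, pointRefl_conj minkowski_comm hmu, pointRefl_conj minkowski_comm h0, boost, boost]
  have hkk : 0 < minkowski k k := by
    have := gamma_pos hv
    rw [hk, apply_pointRefl minkowski_comm hmu, apply_pointRefl minkowski_comm h0,
      minkowski_midVector_self hv]
    positivity
  have hk0 : minkowski k restVector ≠ 0 := by
    rw [minkowski_restVector]
    intro h
    rw [minkowski_self, h] at hkk
    nlinarith [sq_nonneg ‖k.2‖]
  have hvu := norm_eAdd_lt hv hu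
  have hmid : midVector c (eAdd c u (eAdd c v u)) =
      pointRefl minkowski k restVector + restVector := by
    rw [midVector, fourVelocity_eAdd hu hvu, fourVelocity_eAdd hv hu, hconj,
      pointRefl_midVector_restVector hu]
  rw [boost, hmid, pointRefl_pointRefl_add_self hkk.ne' hk0, hconj, ← boost]

/-- The left Bol identity for Einstein addition. -/
theorem eAdd_left_bol (hu : ‖u‖ < c) (hv : ‖v‖ < c) (hw : ‖w‖ < c) :
    eAdd c (eAdd c u (eAdd c v u)) w = eAdd c u (eAdd c v (eAdd c u w)) := by
  have huw := norm_eAdd_lt hu hw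
  have hvuw := norm_eAdd_lt hv huw
  have hq := norm_eAdd_lt hu (norm_eAdd_lt hv hu)
  apply fourVelocity_injOn (norm_eAdd_lt hq hw) (norm_eAdd_lt hu hvuw)
  rw [fourVelocity_eAdd hq hw, boost_eAdd_eAdd hu hv, fourVelocity_eAdd hu hvuw,
    fourVelocity_eAdd hv huw, fourVelocity_eAdd hu hw]

end Minkowski

variable {V : Type*} [NormedAddCommGroup V] [InnerProductSpace ℝ V]

theorem einstein_left_loop (c : ℝ) (hc : 0 < c) (u v w : V)
    (hu : ‖u‖ < c) (hv : ‖v‖ < c) (hw : ‖w‖ < c) :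
    eGyr c (eAdd c u v) v w = eGyr c u v w := by
  have hvw := norm_eAdd_lt hv hw
  have hp := norm_eAdd_lt hu hv
  have hq := norm_eAdd_lt hp hv
  have huz := norm_eAdd_lt hu hvw
  have hu' : ‖-u‖ < c := by rwa [norm_neg]
  have hy := norm_eAdd_lt (u := -eAdd c u v) (by rwa [norm_neg]) huz
  have hbol := eAdd_left_bol hp hu' hy
  rw [eAdd_neg_cancel_left hp huz, neg_eAdd_cancel_left hu hvw, neg_eAdd_cancel_left hu hv] at hbol
  rw [eGyr, eGyr, ← hbol, neg_eAdd_cancel_left hq hy]
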